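/- For every t > 0 and x ∈ ℝ, ∫₀ᵗ p(t−s, x) ds = 2 ∫_{−∞}^{−|x|} Φ(t,y) dy, where Φ(t,y) := ∫_{−∞}^y p(t,w) dw is the Gaussian distribution function. -/

import Mathlib

open MeasureTheory Real Set

/-- The heat kernel `p(t,x) = (2πt)^{-1/2} exp(-x²/(2t))`. -/
noncomputable def heatK (t x : ℝ) : ℝ :=
  (Real.sqrt (2 * Real.pi * t))⁻¹ * Real.exp (-x ^ 2 / (2 * t))

/-- The Gaussian distribution function `Φ(t,y) = ∫_{-∞}^y p(t,w) dw`. -/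
noncomputable def gaussCDF (t y : ℝ) : ℝ := ∫ w in Set.Iic y, heatK t w

open Filter Topology

theorem heatK_nonneg (t x : ℝ) : 0 ≤ heatK t x := by
  unfold heatK; positivity

theorem heatK_neg (t x : ℝ) : heatK t (-x) = heatK t x := by
  simp [heatK]

theorem heatK_abs (t x : ℝ) : heatK t |x| = heatK t x := by
  simp [heatK]

theorem continuous_heatK (t : ℝ) : Continuous (heatK t) := by
  unfold heatK; fun_prop

theorem heatK_eq_exp_neg_mul_sq (t x : ℝ) :
    heatK t x = (√(2 * π * t))⁻¹ * exp (-(1 / (2 * t)) * x ^ 2) := by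
  unfold heatK; congr 2; ring

theorem integrable_heatK {t : ℝ} (ht : 0 < t) : Integrable (heatK t) := by
  simp_rw [funext (heatK_eq_exp_neg_mul_sq t)]
  exact (integrable_exp_neg_mul_sq (by positivity)).const_mul _

theorem integrable_mul_heatK {t : ℝ} (ht : 0 < t) : Integrable fun x => x * heatK t x := by
  have h := (integrable_mul_exp_neg_mul_sq (b := 1 / (2 * t)) (by positivity)).const_mul
    (√(2 * π * t))⁻¹
  refine h.congr (Eventually.of_forall fun x => ?_)
  simp only [heatK_eq_exp_neg_mul_sq]
  ring

theorem integrable_neg_mul_heatK {t : ℝ} (ht : 0 < t) : Integrable fun x => -x * heatK t x :=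
  (integrable_mul_heatK ht).neg.congr (Eventually.of_forall fun x => by simp)

theorem hasDerivAt_heatK {t : ℝ} (ht : 0 < t) (x : ℝ) :
    HasDerivAt (fun y => t * heatK t y) (-x * heatK t x) x := by
  have h : HasDerivAt (fun y : ℝ => -y ^ 2 / (2 * t)) (-x / t) x := by
    refine ((hasDerivAt_pow 2 x).neg.div_const (2 * t)).congr_deriv ?_
    push_cast
    field_simp
  refine ((h.exp.const_mul (√(2 * π * t))⁻¹).const_mul t).congr_deriv ?_
  unfold heatK
  field_simp

theorem tendsto_heatK_atBot {t : ℝ} (ht : 0 < t) : Tendsto (heatK t) atBot (𝓝 0) := by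
  have h : Tendsto (fun x : ℝ => -(1 / (2 * t)) * x ^ 2) atBot atBot :=
    (tendsto_pow_atTop two_ne_zero |>.comp tendsto_neg_atBot_atTop).const_mul_atTop_of_neg
      (r := -(1 / (2 * t))) (by simpa using ht) |>.congr (by simp)
  rw [funext (heatK_eq_exp_neg_mul_sq t)]
  simpa using (tendsto_exp_atBot.comp h).const_mul (√(2 * π * t))⁻¹

theorem integral_Iic_neg_mul_heatK {t : ℝ} (ht : 0 < t) (y : ℝ) :
    ∫ w in Iic y, -w * heatK t w = t * heatK t y := by
  have h := integral_Iic_of_hasDerivAt_of_tendsto' (a := y) (m := 0)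
    (fun w _ => hasDerivAt_heatK ht w)
    (integrable_neg_mul_heatK ht).integrableOn
    (by simpa using (tendsto_heatK_atBot ht).const_mul t)
  simpa using h

theorem gaussCDF_nonneg (t y : ℝ) : 0 ≤ gaussCDF t y :=
  integral_nonneg fun w => heatK_nonneg t w

theorem neg_mul_gaussCDF_le {t : ℝ} (ht : 0 < t) (y : ℝ) :
    -y * gaussCDF t y ≤ t * heatK t y := by
  rw [← integral_Iic_neg_mul_heatK ht, gaussCDF, ← integral_const_mul]
  refine setIntegral_mono_on ((integrable_heatK ht).const_mul _).integrableOn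
    (integrable_neg_mul_heatK ht).integrableOn
    measurableSet_Iic fun w hw => ?_
  exact mul_le_mul_of_nonneg_right (neg_le_neg hw) (heatK_nonneg t w)

theorem tendsto_mul_gaussCDF_atBot {t : ℝ} (ht : 0 < t) :
    Tendsto (fun y => y * gaussCDF t y) atBot (𝓝 0) := by
  have h : Tendsto (fun y => -y * gaussCDF t y) atBot (𝓝 0) := by
    refine tendsto_of_tendsto_of_tendsto_of_le_of_le' tendsto_const_nhds
      (by simpa using (tendsto_heatK_atBot ht).const_mul t) ?_
      (Eventually.of_forall fun y => neg_mul_gaussCDF_le ht y)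
    filter_upwards [eventually_le_atBot 0] with y hy
    exact mul_nonneg (neg_nonneg.2 hy) (gaussCDF_nonneg t y)
  simpa using h.neg

theorem tendsto_gaussCDF_atBot {t : ℝ} (ht : 0 < t) : Tendsto (gaussCDF t) atBot (𝓝 0) := by
  have h := (tendsto_mul_gaussCDF_atBot ht).mul tendsto_inv_atBot_zero
  rw [mul_zero] at h
  refine h.congr' ?_
  filter_upwards [eventually_lt_atBot 0] with y hy
  have := hy.ne
  field_simp

theorem hasDerivAt_gaussCDF {t : ℝ} (ht : 0 < t) (y : ℝ) :
    HasDerivAt (gaussCDF t) (heatK t y) y := by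
  have h := ((continuous_heatK t).integral_hasStrictDerivAt 0 y).hasDerivAt.const_add
    (gaussCDF t 0)
  refine h.congr_of_eventuallyEq (Eventually.of_forall fun z => ?_)
  have := intervalIntegral.integral_Iic_sub_Iic (a := 0) (b := z)
    (integrable_heatK ht).integrableOn (integrable_heatK ht).integrableOn
  simp only [gaussCDF]
  linarith

theorem integral_Iic_gaussCDF {t : ℝ} (ht : 0 < t) (a : ℝ) :
    ∫ y in Iic (-a), gaussCDF t y = t * heatK t a - a * gaussCDF t (-a) := by
  rw [← integral_comp_neg_Ioi]
  have hderiv : ∀ y ∈ Ici a, HasDerivAt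
      (fun y => -(-y * gaussCDF t (-y) + t * heatK t (-y))) (gaussCDF t (-y)) y := by
    intro y _
    have h := ((hasDerivAt_id (-y)).mul (hasDerivAt_gaussCDF ht (-y))).add
      (hasDerivAt_heatK ht (-y))
    refine (h.comp y (hasDerivAt_neg y)).neg.congr_deriv ?_
    simp
  have hlim : Tendsto (fun y => -(-y * gaussCDF t (-y) + t * heatK t (-y))) atTop (𝓝 0) := by
    simpa using (((tendsto_mul_gaussCDF_atBot ht).add
      ((tendsto_heatK_atBot ht).const_mul t)).comp tendsto_neg_atTop_atBot).neg
  rw [integral_Ioi_of_hasDerivAt_of_nonneg' hderiv (fun y _ => gaussCDF_nonneg t _) hlim,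
    heatK_neg]
  ring

theorem gaussCDF_eq_gaussCDF_one {t : ℝ} (ht : 0 < t) (y : ℝ) :
    gaussCDF t y = gaussCDF 1 (y / √t) := by
  have hs : 0 < √t := sqrt_pos.2 ht
  have hderiv : ∀ w ∈ Iic y, HasDerivAt (fun w => gaussCDF 1 (w / √t)) (heatK t w) w := by
    intro w _
    refine ((hasDerivAt_gaussCDF one_pos (w / √t)).comp w
      ((hasDerivAt_id w).div_const _)).congr_deriv ?_
    simp only [heatK, div_pow, sq_sqrt ht.le, sqrt_mul (by positivity : 0 ≤ 2 * π), sqrt_one]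
    field_simp
  simpa [gaussCDF] using integral_Iic_of_hasDerivAt_of_tendsto' hderiv
    (integrable_heatK ht).integrableOn
    ((tendsto_gaussCDF_atBot one_pos).comp (tendsto_id.atBot_div_const hs))

theorem hasDerivAt_heatK_time {a s : ℝ} (hs : 0 < s) :
    HasDerivAt (fun s => 2 * (s * heatK s a - a * gaussCDF 1 (-a / √s))) (heatK s a) s := by
  have hq : 0 < √s := sqrt_pos.2 hs
  have hsq : √s ^ 2 = s := sq_sqrt hs.le
  have hsqrt := (hasDerivAt_id s).sqrt hs.ne'
  have hexp : HasDerivAt (fun s : ℝ => exp (-a ^ 2 / (2 * s)))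
      (exp (-a ^ 2 / (2 * s)) * (a ^ 2 / (2 * s ^ 2))) s := by
    convert (((hasDerivAt_inv hs.ne').const_mul (-a ^ 2 / 2)).exp) using 1
    · ext r; congr 1; ring
    · field_simp
  have hcdf := ((hasDerivAt_gaussCDF one_pos (-a / √s)).comp s
    ((hasDerivAt_const s (-a)).div hsqrt hq.ne')).const_mul a
  have h := (((hsqrt.mul hexp).const_mul (√(2 * π))⁻¹).sub hcdf).const_mul 2
  refine (h.congr_of_eventuallyEq ?_).congr_deriv ?_
  · filter_upwards [eventually_gt_nhds hs] with r hr
    have := sq_sqrt hr.le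
    have hr' : 0 < √r := sqrt_pos.2 hr
    simp only [heatK, sqrt_mul (by positivity : 0 ≤ 2 * π), Function.comp_def, id,
      Pi.mul_apply, Pi.sub_apply, Pi.div_apply]
    nth_rw 1 [← this]
    field_simp
  · have he : -(-a / √s) ^ 2 / (2 * 1) = -a ^ 2 / (2 * s) := by
      rw [div_pow, hsq]; field_simp
    simp only [heatK, sqrt_mul (by positivity : 0 ≤ 2 * π), he, sqrt_one, id]
    rw [show s ^ 2 = √s ^ 4 by nth_rw 1 [← hsq]; ring]
    generalize exp (-a ^ 2 / (2 * s)) = e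
    field_simp
    ring

theorem tendsto_heatK_time_zero {a : ℝ} (ha : 0 ≤ a) :
    Tendsto (fun s => 2 * (s * heatK s a - a * gaussCDF 1 (-a / √s))) (𝓝[>] 0) (𝓝 0) := by
  have hsqrt : Tendsto (fun s : ℝ => √s) (𝓝[>] 0) (𝓝 0) := by
    simpa using (continuous_sqrt.tendsto 0).mono_left nhdsWithin_le_nhds
  have hheat : Tendsto (fun s => s * heatK s a) (𝓝[>] 0) (𝓝 0) := by
    refine squeeze_zero' (g := fun s => (√(2 * π))⁻¹ * √s) ?_ ?_
      (by simpa using hsqrt.const_mul (√(2 * π))⁻¹)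
    · filter_upwards [self_mem_nhdsWithin] with s hs
      exact mul_nonneg (le_of_lt hs) (heatK_nonneg s a)
    · filter_upwards [self_mem_nhdsWithin] with s (hs : 0 < s)
      have hq : 0 < √s := sqrt_pos.2 hs
      have he : exp (-a ^ 2 / (2 * s)) ≤ 1 :=
        exp_le_one_iff.2 (div_nonpos_of_nonpos_of_nonneg (by nlinarith) (by positivity))
      calc s * heatK s a = (√(2 * π))⁻¹ * √s * exp (-a ^ 2 / (2 * s)) := by
            rw [heatK, sqrt_mul (by positivity : 0 ≤ 2 * π)]
            field_simp
            rw [sq_sqrt hs.le]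
        _ ≤ (√(2 * π))⁻¹ * √s := mul_le_of_le_one_right (by positivity) he
  have hcdf : Tendsto (fun s => a * gaussCDF 1 (-a / √s)) (𝓝[>] 0) (𝓝 0) := by
    rcases ha.eq_or_lt with rfl | ha
    · simp
    have hinv : Tendsto (fun s : ℝ => (√s)⁻¹) (𝓝[>] 0) atTop := by
      refine tendsto_inv_nhdsGT_zero.comp (tendsto_nhdsWithin_iff.2 ⟨hsqrt, ?_⟩)
      filter_upwards [self_mem_nhdsWithin] with s hs using sqrt_pos.2 hs
    simpa [div_eq_mul_inv, Function.comp_def] using ((tendsto_gaussCDF_atBot one_pos).comp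
      (hinv.const_mul_atTop_of_neg (neg_neg_of_pos ha))).const_mul a
  simpa using (hheat.sub hcdf).const_mul 2

theorem intervalIntegrable_heatK_time {t : ℝ} (ht : 0 < t) (a : ℝ) :
    IntervalIntegrable (fun s => heatK s a) volume 0 t := by
  have h := (intervalIntegral.intervalIntegrable_rpow' (a := 0) (b := t) (r := -(1 / 2))
    (by norm_num)).const_mul (√(2 * π))⁻¹
  refine h.mono_fun' ?_ ?_
  · have : Measurable fun s => heatK s a := by unfold heatK; fun_prop
    exact this.aestronglyMeasurable
  · rw [uIoc_of_le ht.le]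
    filter_upwards [ae_restrict_mem measurableSet_Ioc] with s hs
    have he : exp (-a ^ 2 / (2 * s)) ≤ 1 :=
      exp_le_one_iff.2 (div_nonpos_of_nonpos_of_nonneg (by nlinarith) (by linarith [hs.1]))
    rw [norm_of_nonneg (heatK_nonneg s a), rpow_neg hs.1.le, ← sqrt_eq_rpow, ← mul_inv,
      ← sqrt_mul (by positivity : 0 ≤ 2 * π)]
    exact mul_le_of_le_one_right (by positivity) he

theorem integral_heatK_time {t a : ℝ} (ht : 0 < t) (ha : 0 ≤ a) :
    ∫ s in (0 : ℝ)..t, heatK s a = 2 * (t * heatK t a - a * gaussCDF t (-a)) := by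
  rw [intervalIntegral.integral_eq_sub_of_hasDerivAt_of_tendsto ht
    (fun s hs => hasDerivAt_heatK_time hs.1) (intervalIntegrable_heatK_time ht a)
    (tendsto_heatK_time_zero ha)
    ((hasDerivAt_heatK_time ht).continuousAt.tendsto.mono_left nhdsWithin_le_nhds),
    gaussCDF_eq_gaussCDF_one ht, sub_zero]

/-- For every `t > 0` and `x ∈ ℝ`, `∫₀ᵗ p(t-s,x) ds = 2 ∫_{-∞}^{-|x|} Φ(t,y) dy`. -/
theorem time_integral_heat_kernel_eq_tail_integral (t : ℝ) (ht : 0 < t) (x : ℝ) :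
    (∫ s in (0:ℝ)..t, heatK (t - s) x) = 2 * ∫ y in Set.Iic (-|x|), gaussCDF t y := by
  rw [integral_Iic_gaussCDF ht, ← integral_heatK_time ht (abs_nonneg x),
    intervalIntegral.integral_comp_sub_left (fun s => heatK s x)]
  simp [heatK_abs]
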